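/- Let a∈(0,∞)^Ṽ and b∈ℝ^Ṽ with a_δ=1 and b_δ=0. Then the joint Laplace transform of (β,θ) under μ^W is given by ∫ exp(−Σ_{i∈V}[(a_i²+b_i²−1)β_i(u)+b_iθ_i(u,s)]) dμ^W(u,s) = L^W(a,b) = ∏_{(i∼j)∈Ẽ}e^{−W_{ij}(a_i a_j+b_i b_j−1)}·∏_{j∈V}a_j^{−1}. -/

import Mathlib

open MeasureTheory Real Finset BigOperators

noncomputable section

/-- The matrix `A^W(u)`: off-diagonal entries `-W i j * exp (u i + u j)`,
diagonal entries `∑ k, W i k * exp (u i + u k)`. -/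
def Amat {V : Type*} [Fintype V] [DecidableEq V] (W : V → V → ℝ) (u : V → ℝ) :
    Matrix V V ℝ :=
  Matrix.of fun i j =>
    if i = j then ∑ k, W i k * Real.exp (u i + u k)
    else -(W i j * Real.exp (u i + u j))

/-- The restriction `A^W_{VV}(u)` of `A^W(u)` to `V×V` where `V = Ṽ∖{δ}`. -/
def AVV {V : Type*} [Fintype V] [DecidableEq V] (W : V → V → ℝ) (δ : V) (u : V → ℝ) :
    Matrix {i : V // i ≠ δ} {i : V // i ≠ δ} ℝ :=
  Matrix.of fun i j => Amat W u i.1 j.1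

/-- The density `ρ^W(u,s)`.  The product over undirected edges
`∏_{(i∼j)∈Ẽ} e^{−W_{ij}(cosh(u_i−u_j)−1)}` is written as
`exp(−(1/2)·Σ_{i,j} W_{ij}(cosh(u_i−u_j)−1))` (sum over all ordered pairs), which agrees
with it since `W` is symmetric and vanishes on the diagonal and off the edge set. -/
def rhoW {V : Type*} [Fintype V] [DecidableEq V] (W : V → V → ℝ) (δ : V) (u s : V → ℝ) :
    ℝ :=
  Real.exp (-(1 / 2) * ∑ i, ∑ j, s i * Amat W u i j * s j)
    * (AVV W δ u).det
    * Real.exp (-((1 / 2) * ∑ i, ∑ j, W i j * (Real.cosh (u i - u j) - 1)))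

/-- Extension of a vector indexed by `V = Ṽ∖{δ}` to `Ṽ` by the value `0` at `δ`. -/
def extendByZero {V : Type*} [DecidableEq V] (δ : V) (x : {i : V // i ≠ δ} → ℝ) : V → ℝ :=
  fun i => if h : i = δ then 0 else x ⟨i, h⟩

/-- The reference measure on `(ℝ^Ṽ)×(ℝ^Ṽ)`: Lebesgue measure on the coordinates in
`V = Ṽ∖{δ}`, with the coordinates at `δ` fixed to `0` (Dirac measure at `0`). -/
def baseMeasure {V : Type*} [Fintype V] [DecidableEq V] (δ : V) :
    Measure ((V → ℝ) × (V → ℝ)) :=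
  Measure.map
    (fun p : ({i : V // i ≠ δ} → ℝ) × ({i : V // i ≠ δ} → ℝ) =>
      (extendByZero δ p.1, extendByZero δ p.2))
    volume

/-- The measure `μ^W(du ds) = ρ^W(u,s)·∏_{i∈V}(2π)^{−1} e^{−u_i} du_i ds_i` on `Ω_V`. -/
def muW {V : Type*} [Fintype V] [DecidableEq V] (W : V → V → ℝ) (δ : V) :
    Measure ((V → ℝ) × (V → ℝ)) :=
  (baseMeasure δ).withDensity fun p =>
    ENNReal.ofReal (rhoW W δ p.1 p.2 *
      ∏ i : {i : V // i ≠ δ}, Real.exp (-(p.1 i.1)) / (2 * Real.pi))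

/-- `β_i(u) = (1/2)·Σ_j W_{ij} e^{u_j−u_i}`. -/
def betaW {V : Type*} [Fintype V] (W : V → V → ℝ) (u : V → ℝ) (i : V) : ℝ :=
  (1 / 2) * ∑ j, W i j * Real.exp (u j - u i)

/-- `θ_i(u,s) = Σ_j W_{ij} e^{u_j}(s_i−s_j)`. -/
def thetaW {V : Type*} [Fintype V] (W : V → V → ℝ) (u s : V → ℝ) (i : V) : ℝ :=
  ∑ j, W i j * Real.exp (u j) * (s i - s j)

/-- The constant `L^W(a,b) = ∏_{(i∼j)∈Ẽ} e^{−W_{ij}(a_i a_j + b_i b_j − 1)}·∏_{j∈V} a_j⁻¹`,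
with the edge product again written via a sum over ordered pairs. -/
def LW {V : Type*} [Fintype V] [DecidableEq V] (W : V → V → ℝ) (δ : V) (a b : V → ℝ) : ℝ :=
  Real.exp (-((1 / 2) * ∑ i, ∑ j, W i j * (a i * a j + b i * b j - 1)))
    * ∏ j : {i : V // i ≠ δ}, (a j.1)⁻¹

open MeasureTheory Real Finset BigOperators
noncomputable section

lemma gauss_lint : ∫⁻ t : ℝ, ENNReal.ofReal (Real.exp (-(t ^ 2) / 2)) = ENNReal.ofReal (√(2 * π)) := by
  have h := integral_gaussian (1 / 2)
  have hi : Integrable (fun t : ℝ => Real.exp (-(1/2) * t ^ 2)) := integrable_exp_neg_mul_sq (by norm_num)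
  rw [← show (π / (1/2)) = 2 * π by ring, ← h, ofReal_integral_eq_lintegral_ofReal hi
    (Filter.Eventually.of_forall fun t => (Real.exp_pos _).le)]
  refine lintegral_congr fun t => ?_
  congr 2; ring

lemma oneD_zero {θ : ℝ} (hθ : 0 < θ) :
    ∫⁻ x in Set.Ioi (0:ℝ), ENNReal.ofReal (Real.exp (-(θ ^ 2 * x) / 2) / √x)
      = ENNReal.ofReal (√(2 * π) / θ) := by
  have hb : (0:ℝ) < θ ^ 2 / 2 := by positivity
  have h := integral_rpow_mul_exp_neg_mul_rpow (p := 1) (q := -(1/2)) (b := θ ^ 2 / 2) one_pos (by norm_num) hb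
  have hval : ∫ x in Set.Ioi (0:ℝ), Real.exp (-(θ ^ 2 * x) / 2) / √x = √(2 * π) / θ := by
    have : ∀ x ∈ Set.Ioi (0:ℝ), x ^ (-(1/2) : ℝ) * Real.exp (-(θ ^ 2 / 2) * x ^ (1:ℝ)) =
        Real.exp (-(θ ^ 2 * x) / 2) / √x := by
      intro x hx
      rw [Real.rpow_neg (le_of_lt hx), ← Real.sqrt_eq_rpow, Real.rpow_one, div_eq_mul_inv, mul_comm]
      congr 2; ring
    rw [← setIntegral_congr_fun measurableSet_Ioi this, h]
    have e1 : (-(1/2) + 1 : ℝ) / 1 = 1 / 2 := by norm_num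
    have e2 : (-(-(1/2) + 1 : ℝ) / 1) = -(1 / 2) := by norm_num
    rw [e1, e2, Real.Gamma_one_half_eq, Real.rpow_neg hb.le, ← Real.sqrt_eq_rpow,
      Real.sqrt_div (by positivity), Real.sqrt_sq hθ.le, Real.sqrt_mul (by norm_num)]
    field_simp
  rw [← hval, ofReal_integral_eq_lintegral_ofReal]
  · by_contra hc
    rw [← IntegrableOn, ] at hc
    have := integral_undef hc
    rw [hval] at this
    have : 0 < √(2 * π) / θ := by positivity
    linarith
  · exact Filter.Eventually.of_forall fun t => by positivity

lemma oneD_pos {θ c : ℝ} (hθ : 0 < θ) (hc : 0 < c) :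
    ∫⁻ x in Set.Ioi (0:ℝ), ENNReal.ofReal (Real.exp (-(θ ^ 2 * x + c ^ 2 / x) / 2) / √x)
      = ENNReal.ofReal (√(2 * π) / θ * Real.exp (-(c * θ))) := by
  set g : ℝ → ℝ := fun v => 2 * √(c / θ) * Real.exp v * Real.exp (-(c * θ * Real.cosh (2 * v))) with hg
  have hgm : Measurable g := by fun_prop
  have h1 : ∫⁻ x in Set.Ioi (0:ℝ), ENNReal.ofReal (Real.exp (-(θ ^ 2 * x + c ^ 2 / x) / 2) / √x)
      = ∫⁻ v, ENNReal.ofReal (g v) := by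
    have him : (fun v : ℝ => c / θ * Real.exp (2 * v)) '' Set.univ = Set.Ioi 0 := by
      ext x
      simp only [Set.image_univ, Set.mem_range, Set.mem_Ioi]
      constructor
      · rintro ⟨v, rfl⟩; positivity
      · intro hx
        refine ⟨Real.log (x * θ / c) / 2, ?_⟩
        rw [mul_div_cancel₀ _ (two_ne_zero), Real.exp_log (by positivity)]
        field_simp
    rw [← him, lintegral_image_eq_lintegral_abs_deriv_mul (f' := fun v => c / θ * (Real.exp (2 * v) * 2)) MeasurableSet.univ]
    · rw [setLIntegral_univ]
      refine lintegral_congr fun v => ?_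
      rw [← ENNReal.ofReal_mul (abs_nonneg _), abs_of_pos (by positivity)]
      congr 1
      have e1 : θ ^ 2 * (c / θ * Real.exp (2 * v)) + c ^ 2 / (c / θ * Real.exp (2 * v))
          = 2 * (c * θ * Real.cosh (2 * v)) := by
        rw [Real.cosh_eq, Real.exp_neg]; field_simp
      have e2 : √(c / θ * Real.exp (2 * v)) = √(c / θ) * Real.exp v := by
        rw [Real.sqrt_mul (by positivity)]
        congr 1
        rw [two_mul, Real.exp_add, Real.sqrt_mul_self (Real.exp_pos _).le]
      rw [e1, e2, hg]
      have e3 : c / θ = √(c / θ) * √(c / θ) := (Real.mul_self_sqrt (by positivity)).symm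
      have e4 : Real.exp (2 * v) = Real.exp v * Real.exp v := by rw [two_mul, Real.exp_add]
      have e5 : -(2 * (c * θ * Real.cosh (2 * v))) / 2 = -(c * θ * Real.cosh (2 * v)) := by ring
      have : √(c / θ) ≠ 0 := by positivity
      rw [e5]
      conv_lhs => rw [e4]; enter [1,1]; rw [e3]
      field_simp
    · intro v _
      have := ((((hasDerivAt_id v).const_mul 2).exp).const_mul (c / θ)).hasDerivWithinAt (s := Set.univ)
      simpa using this
    · intro v _ w _ h
      have : c / θ ≠ 0 := by positivity
      have := Real.exp_injective (mul_left_cancel₀ this h)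
      linarith
  have h2 : ∫⁻ v, ENNReal.ofReal (g v) = ∫⁻ v, ENNReal.ofReal (g (-v)) :=
    ((Measure.measurePreserving_neg (volume : Measure ℝ)).lintegral_comp (by fun_prop)).symm
  have h3 : ENNReal.ofReal (√(2 * π)) =
      ∫⁻ v, ENNReal.ofReal (2 * √(c * θ) * Real.cosh v * Real.exp (-(2 * (c * θ) * Real.sinh v ^ 2))) := by
    rw [← gauss_lint]
    have him : (fun v : ℝ => 2 * √(c * θ) * Real.sinh v) '' Set.univ = Set.univ := by
      rw [Set.image_univ, Set.range_eq_univ]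
      intro y
      obtain ⟨v, hv⟩ := Real.sinh_surjective (y / (2 * √(c * θ)))
      exact ⟨v, by simp only [hv]; field_simp⟩
    conv_lhs => rw [← setLIntegral_univ, ← him]
    rw [lintegral_image_eq_lintegral_abs_deriv_mul (f' := fun v => 2 * √(c * θ) * Real.cosh v) MeasurableSet.univ]
    · rw [setLIntegral_univ]
      refine lintegral_congr fun v => ?_
      have := Real.cosh_pos v
      rw [← ENNReal.ofReal_mul (abs_nonneg _), abs_of_pos (by positivity)]
      congr 3
      have e3 : √(c * θ) ^ 2 = c * θ := (Real.sq_sqrt (by positivity))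
      rw [mul_pow, mul_pow, e3]; ring
    · intro v _
      exact ((Real.hasDerivAt_sinh v).const_mul _).hasDerivWithinAt
    · intro v _ w _ h
      have : 2 * √(c * θ) ≠ 0 := by positivity
      exact Real.sinh_injective (mul_left_cancel₀ this h)
  have h4 : 2 * ∫⁻ v, ENNReal.ofReal (g v) = 2 * ENNReal.ofReal (√(2 * π) / θ * Real.exp (-(c * θ))) := by
    have e1 : √(2 * π) / θ * Real.exp (-(c * θ)) = (Real.exp (-(c * θ)) / θ) * √(2 * π) := by ring
    have e2 : (2 : ENNReal) = ENNReal.ofReal 2 := by simp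
    rw [e1, ENNReal.ofReal_mul (by positivity), h3, two_mul]
    nth_rewrite 2 [h2]
    rw [← lintegral_add_left (by fun_prop), ← lintegral_const_mul _ (by fun_prop), e2,
      ← lintegral_const_mul _ (by fun_prop)]
    refine lintegral_congr fun v => ?_
    have p1 : 0 ≤ g v := by positivity
    have p2 : 0 ≤ g (-v) := by positivity
    rw [← ENNReal.ofReal_add p1 p2, ← ENNReal.ofReal_mul (by positivity), ← ENNReal.ofReal_mul (by positivity)]
    congr 1
    have e4 : Real.cosh (2 * v) = 1 + 2 * Real.sinh v ^ 2 := by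
      rw [Real.cosh_two_mul, Real.cosh_sq]; ring
    have e5 : √(c / θ) = √(c * θ) / θ := by
      rw [show c / θ = c * θ / θ ^ 2 by field_simp, Real.sqrt_div (by positivity), Real.sqrt_sq hθ.le]
    have e6 : Real.exp (-(c * θ * Real.cosh (2 * v))) = Real.exp (-(c * θ)) * Real.exp (-(2 * (c * θ) * Real.sinh v ^ 2)) := by
      rw [← Real.exp_add, e4]; congr 1; ring
    simp only [hg]
    rw [mul_neg, Real.cosh_neg, e5, e6, Real.cosh_eq v]
    ring
  rw [h1]
  exact (ENNReal.mul_right_inj (by norm_num) (by norm_num)).1 h4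

lemma oneD {θ c : ℝ} (hθ : 0 < θ) (hc : 0 ≤ c) :
    ∫⁻ x in Set.Ioi (0:ℝ), ENNReal.ofReal (Real.exp (-(θ ^ 2 * x + c ^ 2 / x) / 2) / √x)
      = ENNReal.ofReal (√(2 * π) / θ * Real.exp (-(c * θ))) := by
  rcases hc.eq_or_lt with rfl | hc
  · simpa using oneD_zero hθ
  · exact oneD_pos hθ hc

lemma oneD_shift {θ c : ℝ} (k : ℝ) (hθ : 0 < θ) (hc : 0 ≤ c) :
    ∫⁻ t : ℝ, (if 0 < 2 * t - k then
      ENNReal.ofReal (Real.exp (-(θ ^ 2 * (2 * t - k) + c ^ 2 / (2 * t - k)) / 2) / √(2 * t - k)) else 0)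
      = ENNReal.ofReal (√(π / 2) / θ * Real.exp (-(c * θ))) := by
  have e : √(π / 2) / θ * Real.exp (-(c * θ)) = (1/2) * (√(2 * π) / θ * Real.exp (-(c * θ))) := by
    rw [show π / 2 = 2 * π / 2 ^ 2 by ring, Real.sqrt_div (by positivity), Real.sqrt_sq (by norm_num)]
    ring
  have him : (fun t : ℝ => (t + k) / 2) '' Set.univ = Set.univ := by
    rw [Set.image_univ, Set.range_eq_univ]
    exact fun y => ⟨2 * y - k, by ring⟩
  rw [e, ENNReal.ofReal_mul (by norm_num), ← oneD hθ hc, ← setLIntegral_univ, ← him,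
    lintegral_image_eq_lintegral_abs_deriv_mul (f' := fun v => 1/2) MeasurableSet.univ,
    setLIntegral_univ, ← lintegral_const_mul _ (by fun_prop), ← lintegral_indicator measurableSet_Ioi]
  · refine lintegral_congr fun x => ?_
    have : 2 * ((x + k) / 2) - k = x := by ring
    simp only [this, Set.indicator, Set.mem_Ioi]
    split_ifs <;> simp
  · intro v _
    simpa using (((hasDerivAt_id v).add_const k).div_const 2).hasDerivWithinAt (s := Set.univ)
  · intro v _ w _ h
    simp only at h; linarith
end
noncomputable section
open Matrix

lemma posDef_real_iff {ι : Type*} [Fintype ι] (A : Matrix ι ι ℝ) :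
    A.PosDef ↔ Aᵀ = A ∧ ∀ x : ι → ℝ, x ≠ 0 → 0 < x ⬝ᵥ (A *ᵥ x) := by
  rw [posDef_iff_dotProduct_mulVec]
  simp [IsHermitian, conjTranspose_eq_transpose_of_trivial]

lemma symm_dot {ι : Type*} [Fintype ι] {A : Matrix ι ι ℝ} (hA : Aᵀ = A) (x y : ι → ℝ) :
    x ⬝ᵥ (A *ᵥ y) = y ⬝ᵥ (A *ᵥ x) := by
  rw [dotProduct_mulVec, ← mulVec_transpose, hA, dotProduct_comm]

lemma mmatrix_nonneg {ι : Type*} [Fintype ι] [DecidableEq ι] {A : Matrix ι ι ℝ} (hA : A.PosDef)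
    (hoff : ∀ i j, i ≠ j → A i j ≤ 0) {η : ι → ℝ} (hη : ∀ i, 0 ≤ η i) (i : ι) :
    0 ≤ (A⁻¹ *ᵥ η) i := by
  set x := A⁻¹ *ᵥ η with hx
  have hAx : A *ᵥ x = η := by
    rw [hx, mulVec_mulVec, mul_nonsing_inv _ ((isUnit_iff_isUnit_det _).1 hA.isUnit), one_mulVec]
  set n : ι → ℝ := fun i => max (-x i) 0 with hn
  have hn0 : ∀ i, 0 ≤ n i := fun i => le_max_right _ _
  have hp0 : ∀ i, 0 ≤ x i + n i := fun i => by
    have : -x i ≤ n i := le_max_left _ _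
    linarith
  have hz : ∀ i, n i * (x i + n i) = 0 := fun i => by
    simp only [hn]
    rcases le_total (-x i) 0 with h | h
    · rw [max_eq_right h]; simp
    · rw [max_eq_left h]; simp
  have hle : n ⬝ᵥ (A *ᵥ (x + n)) ≤ 0 := by
    simp only [dotProduct, mulVec, Finset.mul_sum]
    refine Finset.sum_nonpos fun i _ => Finset.sum_nonpos fun j _ => ?_
    by_cases hij : i = j
    · subst hij
      have := hz i
      have : n i * (A i i * (x + n) i) = A i i * (n i * (x i + n i)) := by simp only [Pi.add_apply]; ring
      rw [this, hz, mul_zero]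
    · have h1 := hoff i j hij
      have h2 := hn0 i
      have h3 := hp0 j
      have : n i * (A i j * (x + n) j) = A i j * (n i * (x j + n j)) := by simp only [Pi.add_apply]; ring
      rw [this]
      exact mul_nonpos_of_nonpos_of_nonneg h1 (mul_nonneg h2 h3)
  rw [mulVec_add, dotProduct_add, hAx] at hle
  have h1 : 0 ≤ n ⬝ᵥ η := Finset.sum_nonneg fun i _ => mul_nonneg (hn0 i) (hη i)
  have hn00 : n = 0 := by
    by_contra h
    have := ((posDef_real_iff A).1 hA).2 n h
    linarith
  have h2 := hp0 i
  rwa [hn00, Pi.zero_apply, add_zero] at h2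

def blk {ι : Type*} (A : Matrix ι ι ℝ) (w : ι → ℝ) (d : ℝ) : Matrix (ι ⊕ Unit) (ι ⊕ Unit) ℝ :=
  fromBlocks A (of fun i _ => -w i) (of fun _ j => -w j) (of fun _ _ => d)

lemma blk_mulVec {ι : Type*} [Fintype ι] (A : Matrix ι ι ℝ) (w : ι → ℝ) (d : ℝ) (p : ι → ℝ) (q : ℝ) :
    blk A w d *ᵥ (Sum.elim p fun _ => q) = Sum.elim (A *ᵥ p - q • w) (fun _ => d * q - w ⬝ᵥ p) := by
  ext (i | i)
  · simp [blk, mulVec, dotProduct]; ring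
  · simp [blk, mulVec, dotProduct, Finset.sum_neg_distrib]; ring

lemma blk_quad {ι : Type*} [Fintype ι] (A : Matrix ι ι ℝ) (w : ι → ℝ) (d : ℝ) (p : ι → ℝ) (q : ℝ) :
    (Sum.elim p fun _ => q) ⬝ᵥ (blk A w d *ᵥ (Sum.elim p fun _ => q))
      = p ⬝ᵥ (A *ᵥ p) - 2 * q * (w ⬝ᵥ p) + d * q ^ 2 := by
  rw [blk_mulVec]
  simp only [sumElim_dotProduct_sumElim, dotProduct_sub, dotProduct_smul, smul_eq_mul]
  rw [dotProduct_comm p w]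
  simp [dotProduct]; ring

lemma sum_elim_eta {ι : Type*} (z : ι ⊕ Unit → ℝ) :
    z = Sum.elim (fun i => z (Sum.inl i)) (fun _ => z (Sum.inr ())) := by
  ext (i | i) <;> simp

section
variable {ι : Type*} [Fintype ι] [DecidableEq ι]

lemma pd_mul_inv {A : Matrix ι ι ℝ} (hA : A.PosDef) (v : ι → ℝ) : A *ᵥ (A⁻¹ *ᵥ v) = v := by
  rw [mulVec_mulVec, mul_nonsing_inv _ ((isUnit_iff_isUnit_det _).1 hA.isUnit), one_mulVec]

lemma pd_inv_mul {A : Matrix ι ι ℝ} (hA : A.PosDef) (v : ι → ℝ) : A⁻¹ *ᵥ (A *ᵥ v) = v := by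
  rw [mulVec_mulVec, nonsing_inv_mul _ ((isUnit_iff_isUnit_det _).1 hA.isUnit), one_mulVec]

lemma blk_posDef_left {A : Matrix ι ι ℝ} {w : ι → ℝ} {d : ℝ} (h : (blk A w d).PosDef) : A.PosDef := by
  have := h.submatrix (e := (Sum.inl : ι → ι ⊕ Unit)) Sum.inl_injective
  exact this

lemma blk_posDef_iff {A : Matrix ι ι ℝ} (hA : A.PosDef) (w : ι → ℝ) (d : ℝ) :
    (blk A w d).PosDef ↔ 0 < d - w ⬝ᵥ (A⁻¹ *ᵥ w) := by
  have hAs := ((posDef_real_iff A).1 hA).1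
  rw [posDef_real_iff]
  constructor
  · rintro ⟨-, h⟩
    have := h (Sum.elim (A⁻¹ *ᵥ w) fun _ => 1) (fun h => by simpa using congrFun h (Sum.inr ()))
    rw [blk_quad, pd_mul_inv hA, dotProduct_comm] at this
    linarith
  · intro h
    refine ⟨?_, fun z hz => ?_⟩
    · ext (i | i) (j | j)
      · exact congrFun (congrFun hAs i) j
      all_goals simp [blk]
    · rw [sum_elim_eta z, blk_quad]
      set p := fun i => z (Sum.inl i) with hp
      set q := z (Sum.inr ()) with hq
      have key : p ⬝ᵥ (A *ᵥ p) - 2 * q * (w ⬝ᵥ p) + d * q ^ 2 =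
          (p - q • (A⁻¹ *ᵥ w)) ⬝ᵥ (A *ᵥ (p - q • (A⁻¹ *ᵥ w))) + (d - w ⬝ᵥ (A⁻¹ *ᵥ w)) * q ^ 2 := by
        rw [mulVec_sub, mulVec_smul, pd_mul_inv hA]
        simp only [sub_dotProduct, dotProduct_sub, smul_dotProduct, dotProduct_smul, smul_eq_mul]
        rw [symm_dot hAs (A⁻¹ *ᵥ w) p, pd_mul_inv hA, dotProduct_comm p w, dotProduct_comm _ w]
        ring
      rw [key]
      have hnn : 0 ≤ (p - q • (A⁻¹ *ᵥ w)) ⬝ᵥ (A *ᵥ (p - q • (A⁻¹ *ᵥ w))) := by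
        by_cases h0 : p - q • (A⁻¹ *ᵥ w) = 0
        · rw [h0]; simp
        · exact (((posDef_real_iff A).1 hA).2 _ h0).le
      by_cases hq0 : q = 0
      · rw [hq0]
        have hp0 : p ≠ 0 := by
          intro hp0
          apply hz
          rw [sum_elim_eta z, ← hq, hq0, ← hp, hp0]
          ext (i | i) <;> simp
        simpa using ((posDef_real_iff A).1 hA).2 _ hp0
      · have : 0 < q ^ 2 := by positivity
        have := mul_pos h this
        linarith

lemma blk_det {A : Matrix ι ι ℝ} (hA : A.PosDef) (w : ι → ℝ) (d : ℝ) :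
    (blk A w d).det = A.det * (d - w ⬝ᵥ (A⁻¹ *ᵥ w)) := by
  let := hA.isUnit.invertible
  rw [blk, det_fromBlocks₁₁, det_unique (n := Unit)]
  congr 1
  simp only [Matrix.sub_apply, of_apply, invOf_eq_nonsing_inv]
  congr 1
  rw [Matrix.mul_assoc]
  simp [mul_apply, dotProduct, mulVec]

lemma blk_inv {A : Matrix ι ι ℝ} (hA : A.PosDef) (w : ι → ℝ) (d : ℝ) (hd : 0 < d - w ⬝ᵥ (A⁻¹ *ᵥ w))
    (η : ι → ℝ) (e : ℝ) :
    (Sum.elim η fun _ => e) ⬝ᵥ ((blk A w d)⁻¹ *ᵥ (Sum.elim η fun _ => e)) =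
      (e + w ⬝ᵥ (A⁻¹ *ᵥ η)) ^ 2 / (d - w ⬝ᵥ (A⁻¹ *ᵥ w)) + η ⬝ᵥ (A⁻¹ *ᵥ η) := by
  have hAs := ((posDef_real_iff A).1 hA).1
  have hAis := ((posDef_real_iff _).1 hA.inv).1
  set x := d - w ⬝ᵥ (A⁻¹ *ᵥ w) with hx
  set c := e + w ⬝ᵥ (A⁻¹ *ᵥ η) with hc
  have h1 : blk A w d *ᵥ (Sum.elim (A⁻¹ *ᵥ η + (c / x) • (A⁻¹ *ᵥ w)) fun _ => c / x)
      = Sum.elim η fun _ => e := by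
    rw [blk_mulVec, mulVec_add, mulVec_smul, pd_mul_inv hA, pd_mul_inv hA, add_sub_cancel_right]
    congr 1
    ext _
    rw [dotProduct_add, dotProduct_smul, smul_eq_mul]
    have : d * (c / x) - (w ⬝ᵥ A⁻¹ *ᵥ η + c / x * w ⬝ᵥ A⁻¹ *ᵥ w) = (c / x) * x - w ⬝ᵥ A⁻¹ *ᵥ η := by
      rw [hx]; ring
    rw [this, div_mul_cancel₀ _ hd.ne', hc]; ring
  have hM : (blk A w d).PosDef := (blk_posDef_iff hA w d).2 hd
  have h2 := pd_inv_mul hM (Sum.elim (A⁻¹ *ᵥ η + (c / x) • (A⁻¹ *ᵥ w)) fun _ => c / x)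
  rw [h1] at h2
  rw [h2, sumElim_dotProduct_sumElim, dotProduct_add, dotProduct_smul, symm_dot hAis η w]
  simp only [smul_eq_mul, dotProduct, Finset.univ_unique, Finset.sum_singleton]
  have : w ⬝ᵥ A⁻¹ *ᵥ η = c - e := by rw [hc]; ring
  simp only [dotProduct] at this
  rw [this]
  ring

end

lemma gauss_multi {ι : Type*} [Fintype ι] [DecidableEq ι] {A : Matrix ι ι ℝ} (hA : A.PosDef) :
    ∫⁻ s : ι → ℝ, ENNReal.ofReal (Real.exp (-(s ⬝ᵥ (A *ᵥ s)) / 2))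
      = ENNReal.ofReal (√(2 * π) ^ Fintype.card ι / √A.det) := by
  obtain ⟨B, hB⟩ : ∃ B : Matrix ι ι ℝ, A = Bᵀ * B := by
    open scoped MatrixOrder ComplexOrder in
    obtain ⟨B, hB⟩ := CStarAlgebra.nonneg_iff_eq_star_mul_self.1 hA.posSemidef.nonneg
    exact ⟨B, by rw [hB, star_eq_conjTranspose, conjTranspose_eq_transpose_of_trivial]⟩
  have hdet : A.det = B.det ^ 2 := by rw [hB, det_mul, det_transpose, sq]
  have hB0 : B.det ≠ 0 := by
    intro h
    have := hA.det_pos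
    rw [hdet, h] at this
    simp at this
  have hmeas : Measurable (fun t : ι → ℝ => ENNReal.ofReal (∏ i, Real.exp (-(t i ^ 2) / 2))) := by
    fun_prop
  have e1 : ∀ s : ι → ℝ, ENNReal.ofReal (Real.exp (-(s ⬝ᵥ (A *ᵥ s)) / 2)) =
      ENNReal.ofReal (∏ i, Real.exp (-((toLin' B s) i ^ 2) / 2)) := by
    intro s
    rw [← Real.exp_sum, ← Finset.sum_div, Finset.sum_neg_distrib]
    congr 4
    rw [hB, ← mulVec_mulVec, dotProduct_mulVec, vecMul_transpose, toLin'_apply]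
    simp [dotProduct, sq]
  have hi : Integrable (fun t : ℝ => Real.exp (-(t ^ 2) / 2)) := by
    have := integrable_exp_neg_mul_sq (b := 1/2) (by norm_num)
    refine this.congr (Filter.Eventually.of_forall fun t => ?_)
    simp only; congr 1; ring
  have hprod : ∫⁻ t : ι → ℝ, ENNReal.ofReal (∏ i, Real.exp (-(t i ^ 2) / 2)) = ENNReal.ofReal (√(2 * π) ^ Fintype.card ι) := by
    rw [← ofReal_integral_eq_lintegral_ofReal]
    · rw [integral_fintype_prod_volume_eq_pow (fun t : ℝ => Real.exp (-(t ^ 2) / 2))]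
      congr 2
      have h := integral_gaussian (1 / 2)
      rw [← show (π / (1/2)) = 2 * π by ring, ← h]
      congr 1; ext t; congr 1; ring
    · exact Integrable.fintype_prod (f := fun _ t => Real.exp (-(t ^ 2) / 2)) (fun _ => hi)
    · exact Filter.Eventually.of_forall fun t => Finset.prod_nonneg fun i _ => (Real.exp_pos _).le
  have hlin : Measurable (toLin' B) := (LinearMap.continuous_on_pi _).measurable
  rw [lintegral_congr e1, ← lintegral_map (f := fun t : ι → ℝ => ENNReal.ofReal (∏ i, Real.exp (-(t i ^ 2) / 2))) hmeas hlin,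
    Real.map_matrix_volume_pi_eq_smul_volume_pi hB0, lintegral_smul_measure, hprod, smul_eq_mul,
    ← ENNReal.ofReal_mul (abs_nonneg _), hdet, Real.sqrt_sq_eq_abs, abs_inv]
  congr 1; ring
end
noncomputable section
open Matrix

def Hm {ι : Type*} [DecidableEq ι] (W : Matrix ι ι ℝ) (β : ι → ℝ) : Matrix ι ι ℝ :=
  diagonal (fun i => 2 * β i) - W

open Classical in
def Gint {ι : Type*} [Fintype ι] [DecidableEq ι] (A : Matrix ι ι ℝ) (θ η : ι → ℝ) : ENNReal :=
  if A.PosDef then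
    ENNReal.ofReal (Real.exp (-(θ ⬝ᵥ (A *ᵥ θ) + η ⬝ᵥ (A⁻¹ *ᵥ η)) / 2) / √A.det)
  else 0

lemma Gint_pos {ι : Type*} [Fintype ι] [DecidableEq ι] {A : Matrix ι ι ℝ} (hA : A.PosDef) (θ η : ι → ℝ) :
    Gint A θ η = ENNReal.ofReal (Real.exp (-(θ ⬝ᵥ (A *ᵥ θ) + η ⬝ᵥ (A⁻¹ *ᵥ η)) / 2) / √A.det) :=
  if_pos hA

lemma Gint_neg {ι : Type*} [Fintype ι] [DecidableEq ι] {A : Matrix ι ι ℝ} (hA : ¬ A.PosDef) (θ η : ι → ℝ) :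
    Gint A θ η = 0 := if_neg hA

def Fint {ι : Type*} [Fintype ι] [DecidableEq ι] (W : Matrix ι ι ℝ) (θ η β : ι → ℝ) : ENNReal :=
  Gint (Hm W β) θ η

section
variable {ι : Type*} [Fintype ι] [DecidableEq ι]

lemma continuous_Hm (W : Matrix ι ι ℝ) : Continuous (Hm W) := by
  unfold Hm
  fun_prop

lemma isClosed_psd : IsClosed {A : Matrix ι ι ℝ | A.PosSemidef} := by
  have : {A : Matrix ι ι ℝ | A.PosSemidef} = {A | Aᵀ = A} ∩ ⋂ x : ι → ℝ, {A | 0 ≤ x ⬝ᵥ (A *ᵥ x)} := by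
    ext A
    simp [posSemidef_iff_dotProduct_mulVec, IsHermitian, conjTranspose_eq_transpose_of_trivial]
  rw [this]
  refine (isClosed_eq (by fun_prop) (by fun_prop)).inter (isClosed_iInter fun x => ?_)
  exact isClosed_le (by fun_prop) (by fun_prop)

lemma measurableSet_pd (W : Matrix ι ι ℝ) : MeasurableSet {β | (Hm W β).PosDef} := by
  have : {β | (Hm W β).PosDef} = {β | (Hm W β).PosSemidef} ∩ {β | (Hm W β).det ≠ 0} := by
    ext β
    constructor
    · intro h; exact ⟨h.posSemidef, h.det_pos.ne'⟩
    · rintro ⟨h1, h2⟩; exact h1.posDef_iff_det_ne_zero.2 h2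
  rw [this]
  refine (isClosed_psd.preimage (continuous_Hm W)).measurableSet.inter ?_
  exact (isOpen_ne_fun ((continuous_Hm W).matrix_det) continuous_const).measurableSet

lemma measurable_Fint (W : Matrix ι ι ℝ) (θ η : ι → ℝ) : Measurable (Fint W θ η) := by
  unfold Fint Gint
  have hc := continuous_Hm W
  refine Measurable.ite (measurableSet_pd W) ?_ measurable_const
  have h1 : Measurable fun β => θ ⬝ᵥ (Hm W β *ᵥ θ) := by
    apply Continuous.measurable; fun_prop
  have h3 : Measurable fun β => (Hm W β).det := hc.matrix_det.measurable
  have h2 : Measurable fun β => η ⬝ᵥ ((Hm W β)⁻¹ *ᵥ η) := by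
    simp only [Matrix.inv_def, smul_mulVec, dotProduct_smul, Ring.inverse_eq_inv', smul_eq_mul]
    refine h3.inv.mul ?_
    apply Continuous.measurable
    have := hc.matrix_adjugate
    fun_prop
  exact ((((h1.add h2).neg.div_const 2).exp).div h3.sqrt).ennreal_ofReal

def Claim (ι : Type*) [Fintype ι] [DecidableEq ι] : Prop :=
  ∀ (W : Matrix ι ι ℝ) (θ η : ι → ℝ), (∀ i j, W i j = W j i) → (∀ i j, 0 ≤ W i j) →
    (∀ i, 0 < θ i) → (∀ i, 0 ≤ η i) →
    ∫⁻ β, Fint W θ η β =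
      ENNReal.ofReal (Real.exp (-(η ⬝ᵥ θ)) * √(π / 2) ^ Fintype.card ι / ∏ i, θ i)

lemma Hm_sum (W : Matrix (ι ⊕ Unit) (ι ⊕ Unit) ℝ) (hs : ∀ i j, W i j = W j i) (β : ι → ℝ) (t : ℝ) :
    Hm W (Sum.elim β fun _ => t) = blk (Hm (W.submatrix Sum.inl Sum.inl) β)
      (fun i => W (Sum.inl i) (Sum.inr ())) (2 * t - W (Sum.inr ()) (Sum.inr ())) := by
  ext (i | i) (j | j)
  · simp [Hm, blk, diagonal_apply]
  · simp [Hm, blk, diagonal_apply]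
  · simp [Hm, blk, diagonal_apply, hs]
  · simp [Hm, blk, diagonal_apply]

lemma Fint_sum (W : Matrix (ι ⊕ Unit) (ι ⊕ Unit) ℝ) (hs : ∀ i j, W i j = W j i) (h0 : ∀ i j, 0 ≤ W i j)
    (θ η : ι → ℝ) (θ1 η1 : ℝ) (hη : ∀ i, 0 ≤ η i) (hθ1 : 0 < θ1) (hη1 : 0 ≤ η1)
    (β : ι → ℝ) :
    ∫⁻ t : ℝ, Fint W (Sum.elim θ fun _ => θ1) (Sum.elim η fun _ => η1) (Sum.elim β fun _ => t) =
    ENNReal.ofReal (√(π / 2) / θ1 * Real.exp (-(η1 * θ1)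
        + θ1 * ((fun i => W (Sum.inl i) (Sum.inr ())) ⬝ᵥ θ))) *
      Fint (W.submatrix Sum.inl Sum.inl) θ (η + θ1 • fun i => W (Sum.inl i) (Sum.inr ())) β := by
  set w : ι → ℝ := fun i => W (Sum.inl i) (Sum.inr ()) with hw
  set A := Hm (W.submatrix Sum.inl Sum.inl) β with hAdef
  unfold Fint
  simp only [Hm_sum W hs]
  rw [← hw, ← hAdef]
  by_cases hA : A.PosDef
  · rw [Gint_pos hA]
    have hoff : ∀ i j, i ≠ j → A i j ≤ 0 := fun i j hij => by
      simp [hAdef, Hm, diagonal_apply_ne _ hij, h0]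
    have hc : 0 ≤ η1 + w ⬝ᵥ (A⁻¹ *ᵥ η) :=
      add_nonneg hη1 (Finset.sum_nonneg fun i _ => mul_nonneg (h0 _ _) (mmatrix_nonneg hA hoff hη i))
    have hdet := hA.det_pos
    have hsq : 0 < √A.det := Real.sqrt_pos.2 hdet
    have hAis := ((posDef_real_iff _).1 hA.inv).1
    set k := W (Sum.inr ()) (Sum.inr ()) + w ⬝ᵥ (A⁻¹ *ᵥ w) with hk
    set C := Real.exp (-(θ ⬝ᵥ (A *ᵥ θ) - 2 * θ1 * (w ⬝ᵥ θ) + θ1 ^ 2 * (w ⬝ᵥ (A⁻¹ *ᵥ w)) + η ⬝ᵥ (A⁻¹ *ᵥ η)) / 2) / √A.det with hC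
    have hC0 : 0 ≤ C := by positivity
    have hone := oneD_shift k hθ1 hc
    have e1 : ∀ t : ℝ, Gint (blk A w (2 * t - W (Sum.inr ()) (Sum.inr ())))
        (Sum.elim θ fun _ => θ1) (Sum.elim η fun _ => η1) =
        ENNReal.ofReal C * (if 0 < 2 * t - k then
      ENNReal.ofReal (Real.exp (-(θ1 ^ 2 * (2 * t - k) + (η1 + w ⬝ᵥ (A⁻¹ *ᵥ η)) ^ 2 / (2 * t - k)) / 2) / √(2 * t - k)) else 0) := by
      intro t
      have hd : 2 * t - W (Sum.inr ()) (Sum.inr ()) - w ⬝ᵥ (A⁻¹ *ᵥ w) = 2 * t - k := by rw [hk]; ring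
      by_cases hp : 0 < 2 * t - k
      · rw [if_pos hp, Gint_pos ((blk_posDef_iff hA _ _).2 (by rwa [hd])), ← ENNReal.ofReal_mul hC0]
        congr 1
        rw [blk_quad, blk_inv hA _ _ (by rwa [hd]), blk_det hA, hd, Real.sqrt_mul hdet.le, hC,
          div_mul_div_comm, ← Real.exp_add]
        congr 2
        have : 2 * t - W (Sum.inr ()) (Sum.inr ()) = 2 * t - k + w ⬝ᵥ (A⁻¹ *ᵥ w) := by rw [hk]; ring
        rw [this]
        ring
      · rw [if_neg hp, Gint_neg (by rw [blk_posDef_iff hA, hd]; exact hp), mul_zero]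
    rw [lintegral_congr e1, lintegral_const_mul' _ _ ENNReal.ofReal_ne_top, hone,
      ← ENNReal.ofReal_mul hC0, ← ENNReal.ofReal_mul (by positivity)]
    congr 1
    rw [hC]
    have e2 : ∀ P Q R S T D : ℝ, Real.exp P / D * (S / T * Real.exp Q) = (Real.exp (P + Q)) * (S / T / D) := by
      intros; rw [Real.exp_add]; ring
    have e3 : ∀ P Q S T D : ℝ, (S / T * Real.exp Q) * (Real.exp P / D) = (Real.exp (P + Q)) * (S / T / D) := by
      intros; rw [Real.exp_add]; ring
    rw [e2 _ _ 0, e3]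
    congr 2
    simp only [mulVec_add, mulVec_smul, add_dotProduct, dotProduct_add, smul_dotProduct, dotProduct_smul, smul_eq_mul]
    rw [symm_dot hAis η w]
    ring
  · rw [Gint_neg hA, mul_zero]
    have : ∀ t : ℝ, ¬ (blk A w (2 * t - W (Sum.inr ()) (Sum.inr ()))).PosDef := fun t h => hA (blk_posDef_left h)
    simp [Gint_neg (this _)]

lemma claim_sum (h : Claim ι) : Claim (ι ⊕ Unit) := by
  intro W θ η hs h0 hθ hη
  have hm := measurable_Fint W θ η
  have e := (volume_measurePreserving_sumPiEquivProdPi_symm (fun _ : ι ⊕ Unit => ℝ)).lintegral_comp hm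
  rw [← e]
  rw [Measure.volume_eq_prod, lintegral_prod _ (by
    exact (hm.comp (MeasurableEquiv.measurable _)).aemeasurable)]
  have e1 : ∀ β : ι → ℝ, ∫⁻ y : Unit → ℝ, Fint W θ η ((MeasurableEquiv.sumPiEquivProdPi (fun _ : ι ⊕ Unit => ℝ)).symm (β, y))
      = ∫⁻ t : ℝ, Fint W θ η (Sum.elim β fun _ => t) := by
    intro β
    rw [← (volume_preserving_funUnique Unit ℝ).lintegral_comp_emb (MeasurableEquiv.measurableEmbedding _)]
    refine lintegral_congr fun y => ?_
    congr 1
  have e2 := fun β => Fint_sum W hs h0 (fun i => θ (Sum.inl i)) (fun i => η (Sum.inl i)) (θ (Sum.inr ())) (η (Sum.inr ()))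
    (fun i => hη _) (hθ _) (hη _) β
  simp only [← sum_elim_eta] at e2
  rw [lintegral_congr fun β => (e1 β).trans (e2 β), lintegral_const_mul' _ _ ENNReal.ofReal_ne_top,
    h (W.submatrix Sum.inl Sum.inl) (fun i => θ (Sum.inl i)) _ (fun i j => hs _ _) (fun i j => h0 _ _) (fun i => hθ _), ← ENNReal.ofReal_mul]
  · congr 1
    have p1 : 0 < θ (Sum.inr ()) := hθ _
    have p2 : 0 < ∏ i, θ (Sum.inl i) := Finset.prod_pos fun i _ => hθ _
    have hsum : η ⬝ᵥ θ = (fun i => η (Sum.inl i)) ⬝ᵥ (fun i => θ (Sum.inl i)) + η (Sum.inr ()) * θ (Sum.inr ()) := by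
      simp [dotProduct]
    rw [Fintype.prod_sum_type, Fintype.card_sum, Fintype.card_unit, pow_succ, hsum]
    simp only [add_dotProduct, smul_dotProduct, smul_eq_mul, Finset.univ_unique, Finset.prod_singleton, PUnit.default_eq_unit]
    have e3 : ∀ P Q S T D X : ℝ, (S / T * Real.exp Q) * (Real.exp P * X / D) = (Real.exp (Q + P)) * (X * S) / (D * T) := by
      intros; rw [Real.exp_add]; ring
    rw [e3]
    congr 3
    ring
  · have p1 : 0 < θ (Sum.inr ()) := hθ _
    positivity
  · intro i
    exact add_nonneg (hη _) (mul_nonneg (hθ _).le (h0 _ _))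

lemma claim_equiv {κ : Type*} [Fintype κ] [DecidableEq κ] (e : ι ≃ κ) (h : Claim ι) : Claim κ := by
  intro W θ η hs h0 hθ hη
  have h1 := h (W.submatrix e e) (θ ∘ e) (η ∘ e) (fun i j => hs _ _) (fun i j => h0 _ _) (fun i => hθ _) (fun i => hη _)
  have hF : ∀ β : κ → ℝ, Fint (W.submatrix e e) (θ ∘ e) (η ∘ e) (β ∘ e) = Fint W θ η β := by
    intro β
    have hH : Hm (W.submatrix e e) (β ∘ e) = (Hm W β).submatrix e e := by
      ext i j; simp [Hm, diagonal_apply]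
    have hpd : ((Hm W β).submatrix e e).PosDef ↔ (Hm W β).PosDef := by
      constructor
      · intro h
        have := h.submatrix e.symm.injective
        simpa using this
      · intro h; exact h.submatrix e.injective
    unfold Fint
    rw [hH]
    by_cases hp : (Hm W β).PosDef
    swap
    · rw [Gint_neg hp, Gint_neg (by rwa [hpd])]
    rw [Gint_pos hp, Gint_pos (hpd.2 hp)]
    simp only [det_submatrix_equiv_self, inv_submatrix_equiv, submatrix_mulVec_equiv,
      Function.comp_assoc, Equiv.self_comp_symm, Function.comp_id, comp_equiv_dotProduct_comp_equiv]
  have hm := measurable_Fint W θ η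
  have e2 := (volume_measurePreserving_piCongrLeft (fun _ : κ => ℝ) e).lintegral_comp hm
  rw [← e2]
  have e3 : ∀ β : ι → ℝ, Fint W θ η (MeasurableEquiv.piCongrLeft (fun _ : κ => ℝ) e β) =
      Fint (W.submatrix e e) (θ ∘ e) (η ∘ e) β := by
    intro β
    rw [← hF]
    congr 1
    ext i
    exact Equiv.piCongrLeft_apply_apply (fun _ : κ => ℝ) e β i
  rw [lintegral_congr e3, h1, comp_equiv_dotProduct_comp_equiv, Fintype.card_congr e]
  congr 2
  exact Equiv.prod_comp e θ

lemma claim_empty : Claim (Fin 0) := by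
  intro W θ η hs h0 hθ hη
  have : ∀ β, Fint W θ η β = 1 := by
    intro β
    have : (Hm W β).PosDef := by
      rw [posDef_real_iff]
      exact ⟨Subsingleton.elim _ _, fun x hx => absurd (Subsingleton.elim _ _) hx⟩
    simp [Fint, Gint_pos this]
  simp [this, volume_pi, Measure.pi_of_empty]

lemma claim_fin (n : ℕ) : Claim (Fin n) := by
  induction n with
  | zero => exact claim_empty
  | succ n ih =>
    exact claim_equiv ((Equiv.sumCongr (Equiv.refl _) finOneEquiv.symm).trans finSumFinEquiv) (claim_sum ih)

theorem claim_all : Claim ι := claim_equiv (Fintype.equivFin ι).symm (claim_fin _)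
end
end
section
open Matrix
variable {V : Type*} [Fintype V] [DecidableEq V] (W : V → V → ℝ) (δ : V)

lemma ext_delta (x : {i : V // i ≠ δ} → ℝ) : extendByZero δ x δ = 0 := by simp [extendByZero]

lemma ext_ne (x : {i : V // i ≠ δ} → ℝ) (i : {i : V // i ≠ δ}) : extendByZero δ x i.1 = x i := by
  simp [extendByZero, i.2]

lemma sum_split (f : V → ℝ) : ∑ i, f i = f δ + ∑ i : {i : V // i ≠ δ}, f i.1 :=
  Fintype.sum_eq_add_sum_subtype_ne f δ

lemma Amat_apply_sum (hdiag : ∀ i, W i i = 0) (u s : V → ℝ) (i : V) :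
    ∑ j, Amat W u i j * s j = ∑ j, W i j * Real.exp (u i + u j) * (s i - s j) := by
  have h1 : ∀ j, Amat W u i j * s j =
      (if i = j then (∑ k, W i k * Real.exp (u i + u k)) * s i else 0) - W i j * Real.exp (u i + u j) * s j := by
    intro j
    by_cases h : i = j
    · subst h; simp [Amat, hdiag]
    · simp [Amat, h]
  simp only [h1, Finset.sum_sub_distrib, Finset.sum_ite_eq, Finset.mem_univ, if_true, mul_sub, Finset.sum_mul]

lemma Amat_theta (hdiag : ∀ i, W i i = 0) (u s : V → ℝ) (i : V) :
    ∑ j, Amat W u i j * s j = Real.exp (u i) * thetaW W u s i := by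
  rw [Amat_apply_sum W hdiag, thetaW, Finset.mul_sum]
  refine Finset.sum_congr rfl fun j _ => ?_
  rw [Real.exp_add]; ring

lemma Amat_quad (hsymm : ∀ i j, W i j = W j i) (hdiag : ∀ i, W i i = 0) (u s : V → ℝ) :
    ∑ i, ∑ j, s i * Amat W u i j * s j
      = (1 / 2) * ∑ i, ∑ j, W i j * Real.exp (u i + u j) * (s i - s j) ^ 2 := by
  have h1 : ∑ i, ∑ j, s i * Amat W u i j * s j = ∑ i, ∑ j, W i j * Real.exp (u i + u j) * (s i - s j) * s i := by
    refine Finset.sum_congr rfl fun i _ => ?_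
    have := Amat_apply_sum W hdiag u s i
    simp only [mul_assoc, ← Finset.mul_sum] at this ⊢
    rw [this, Finset.mul_sum]
    refine Finset.sum_congr rfl fun j _ => by ring
  have h2 : ∑ i, ∑ j, W i j * Real.exp (u i + u j) * (s i - s j) * s i
      = ∑ i, ∑ j, W i j * Real.exp (u i + u j) * (s j - s i) * s j := by
    rw [Finset.sum_comm]
    refine Finset.sum_congr rfl fun j _ => Finset.sum_congr rfl fun i _ => ?_
    rw [hsymm i j, add_comm]
  have h3 : ∑ i, ∑ j, W i j * Real.exp (u i + u j) * (s i - s j) ^ 2 =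
      ∑ i, ∑ j, W i j * Real.exp (u i + u j) * (s i - s j) * s i +
      ∑ i, ∑ j, W i j * Real.exp (u i + u j) * (s j - s i) * s j := by
    simp only [← Finset.sum_add_distrib]
    refine Finset.sum_congr rfl fun j _ => Finset.sum_congr rfl fun i _ => by ring
  rw [h3, ← h2, h1]; ring

lemma AVV_mulVec (u : V → ℝ) (x : {i : V // i ≠ δ} → ℝ) (i : {i : V // i ≠ δ}) :
    (AVV W δ u *ᵥ x) i = ∑ j, Amat W u i.1 j * extendByZero δ x j := by
  rw [sum_split δ, ext_delta]
  simp [AVV, mulVec, dotProduct, ext_ne]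

lemma AVV_quad (u : V → ℝ) (x : {i : V // i ≠ δ} → ℝ) :
    ∑ i, ∑ j, extendByZero δ x i * Amat W u i j * extendByZero δ x j = x ⬝ᵥ (AVV W δ u *ᵥ x) := by
  rw [sum_split δ]
  simp only [ext_delta, ext_ne, zero_mul, Finset.sum_const_zero, zero_add, dotProduct, AVV_mulVec,
    Finset.mul_sum, mul_assoc]

lemma conn_zero (hsymm : ∀ i j, W i j = W j i)
    (hconn : (SimpleGraph.fromRel fun i j : V => 0 < W i j).Connected) (P : V → Prop)
    (hstep : ∀ i j, 0 < W i j → P i → P j) (i j : V) (hi : P i) : P j := by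
  obtain ⟨w⟩ := hconn.preconnected i j
  induction w with
  | nil => exact hi
  | cons h _ ih =>
    apply ih
    rw [SimpleGraph.fromRel_adj] at h
    rcases h.2 with h | h
    · exact hstep _ _ h hi
    · exact hstep _ _ (by rwa [hsymm]) hi

lemma AVV_posDef (hsymm : ∀ i j, W i j = W j i) (hdiag : ∀ i, W i i = 0) (hnonneg : ∀ i j, 0 ≤ W i j)
    (hconn : (SimpleGraph.fromRel fun i j : V => 0 < W i j).Connected) (u : V → ℝ) :
    (AVV W δ u).PosDef := by
  rw [posDef_real_iff]
  constructor
  · ext i j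
    simp only [AVV, Amat, transpose_apply, of_apply]
    by_cases h : i = j
    · subst h; rfl
    · have h' : i.1 ≠ j.1 := fun e => h (Subtype.ext e)
      rw [if_neg h', if_neg h'.symm, hsymm, add_comm]
  · intro x hx
    rw [← AVV_quad, Amat_quad W hsymm hdiag]
    set s := extendByZero δ x with hs
    have hnn : ∀ i j, 0 ≤ W i j * Real.exp (u i + u j) * (s i - s j) ^ 2 := fun i j =>
      mul_nonneg (mul_nonneg (hnonneg _ _) (Real.exp_pos _).le) (sq_nonneg _)
    have hnn2 : 0 ≤ ∑ i, ∑ j, W i j * Real.exp (u i + u j) * (s i - s j) ^ 2 :=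
      Finset.sum_nonneg fun i _ => Finset.sum_nonneg fun j _ => hnn i j
    rcases hnn2.eq_or_lt with h | h
    · exfalso
      apply hx
      have h1 := (Finset.sum_eq_zero_iff_of_nonneg (fun i _ => Finset.sum_nonneg fun j _ => hnn i j)).1 h.symm
      have h2 : ∀ i j, 0 < W i j → s i = s j := by
        intro i j hij
        have := (Finset.sum_eq_zero_iff_of_nonneg (fun j _ => hnn i j)).1 (h1 i (Finset.mem_univ _)) j (Finset.mem_univ _)
        have hp : W i j * Real.exp (u i + u j) ≠ 0 := by positivity
        have := (mul_eq_zero.1 this).resolve_left hp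
        exact sub_eq_zero.1 (pow_eq_zero_iff (two_ne_zero) |>.1 this)
      ext i
      have := conn_zero W hsymm hconn (fun i => s i = 0) (fun i j hij hi => by rw [← h2 i j hij]; exact hi)
        δ i.1 (ext_delta δ x)
      simpa [hs, ext_ne] using this
    · linarith

/-- restriction of the weights -/
def Wr : Matrix {i : V // i ≠ δ} {i : V // i ≠ δ} ℝ := of fun i j => W i.1 j.1

def bmap (u : {i : V // i ≠ δ} → ℝ) : {i : V // i ≠ δ} → ℝ := fun i => betaW W (extendByZero δ u) i.1

lemma two_beta (u : {i : V // i ≠ δ} → ℝ) (i : {i : V // i ≠ δ}) :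
    2 * bmap W δ u i * Real.exp (u i) = W i.1 δ + ∑ j : {i : V // i ≠ δ}, W i.1 j.1 * Real.exp (u j) := by
  unfold bmap betaW
  rw [sum_split δ]
  simp only [ext_delta, ext_ne]
  have h : ∀ y : ℝ, Real.exp (y - u i) = Real.exp y / Real.exp (u i) := fun y => Real.exp_sub _ _
  simp only [h, Real.exp_zero]
  have := (Real.exp_pos (u i)).ne'
  simp only [← mul_div_assoc, ← Finset.sum_div]
  field_simp

lemma Hm_bmap_mulVec (u : {i : V // i ≠ δ} → ℝ) :
    Hm (Wr W δ) (bmap W δ u) *ᵥ (fun i => Real.exp (u i)) = fun i => W i.1 δ := by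
  ext i
  have := two_beta W δ u i
  simp only [Hm, sub_mulVec, Pi.sub_apply, mulVec_diagonal, this]
  simp [Wr, mulVec, dotProduct]

lemma Hm_bmap_eq (hdiag : ∀ i, W i i = 0) (u : {i : V // i ≠ δ} → ℝ) :
    Hm (Wr W δ) (bmap W δ u) = diagonal (fun i => Real.exp (-u i)) * AVV W δ (extendByZero δ u)
      * diagonal (fun i => Real.exp (-u i)) := by
  ext i j
  rw [mul_diagonal, diagonal_mul]
  by_cases h : i = j
  · subst h
    simp only [Hm, Wr, Matrix.sub_apply, diagonal_apply_eq, of_apply, hdiag, sub_zero, AVV, Amat, if_true, bmap, betaW, ext_ne]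
    rw [Finset.mul_sum, Finset.mul_sum, Finset.mul_sum, Finset.sum_mul]
    refine Finset.sum_congr rfl fun k _ => ?_
    rw [Real.exp_add, Real.exp_sub, Real.exp_neg]
    field_simp
  · have h' : i.1 ≠ j.1 := fun e => h (Subtype.ext e)
    simp only [Hm, Wr, Matrix.sub_apply, diagonal_apply_ne _ h, of_apply, AVV, Amat, if_neg h', ext_ne]
    rw [Real.exp_add, Real.exp_neg, Real.exp_neg]
    field_simp
    ring

lemma Hm_bmap_posDef (hsymm : ∀ i j, W i j = W j i) (hdiag : ∀ i, W i i = 0) (hnonneg : ∀ i j, 0 ≤ W i j)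
    (hconn : (SimpleGraph.fromRel fun i j : V => 0 < W i j).Connected) (u : {i : V // i ≠ δ} → ℝ) :
    (Hm (Wr W δ) (bmap W δ u)).PosDef := by
  rw [Hm_bmap_eq W δ hdiag]
  have hA := AVV_posDef W δ hsymm hdiag hnonneg hconn (extendByZero δ u)
  have hD : Function.Injective (diagonal (fun i => Real.exp (-u i))).mulVec := by
    intro x y h
    ext i
    have := congrFun h i
    simp only [mulVec_diagonal] at this
    exact mul_left_cancel₀ (Real.exp_pos _).ne' this
  have := hA.conjTranspose_mul_mul_same hD
  simpa [conjTranspose_eq_transpose_of_trivial] using this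

lemma Hm_bmap_det (hdiag : ∀ i, W i i = 0) (u : {i : V // i ≠ δ} → ℝ) :
    (Hm (Wr W δ) (bmap W δ u)).det = (∏ i, Real.exp (-u i)) ^ 2 * (AVV W δ (extendByZero δ u)).det := by
  rw [Hm_bmap_eq W δ hdiag, det_mul, det_mul, det_diagonal]; ring

lemma bmap_injective (hsymm : ∀ i j, W i j = W j i) (hdiag : ∀ i, W i i = 0) (hnonneg : ∀ i j, 0 ≤ W i j)
    (hconn : (SimpleGraph.fromRel fun i j : V => 0 < W i j).Connected) : Function.Injective (bmap W δ) := by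
  intro u v h
  have hP := Hm_bmap_posDef W δ hsymm hdiag hnonneg hconn u
  have h1 := pd_inv_mul hP (fun i => Real.exp (u i))
  have h2 := pd_inv_mul hP (fun i => Real.exp (v i))
  rw [Hm_bmap_mulVec] at h1
  nth_rewrite 2 [h] at h2
  rw [Hm_bmap_mulVec, h1] at h2
  ext i
  exact Real.exp_injective (congrFun h2 i)

lemma bmap_range (hsymm : ∀ i j, W i j = W j i) (hdiag : ∀ i, W i i = 0) (hnonneg : ∀ i j, 0 ≤ W i j)
    (hconn : (SimpleGraph.fromRel fun i j : V => 0 < W i j).Connected) :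
    bmap W δ '' Set.univ = {β | (Hm (Wr W δ) β).PosDef} := by
  ext β
  simp only [Set.image_univ, Set.mem_range, Set.mem_setOf_eq]
  constructor
  · rintro ⟨u, rfl⟩
    exact Hm_bmap_posDef W δ hsymm hdiag hnonneg hconn u
  · intro hP
    set x := (Hm (Wr W δ) β)⁻¹ *ᵥ (fun i : {i : V // i ≠ δ} => W i.1 δ) with hx
    have hHx : Hm (Wr W δ) β *ᵥ x = fun i => W i.1 δ := pd_mul_inv hP _
    have hx0 : ∀ i, 0 ≤ x i := mmatrix_nonneg hP (fun i j hij => by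
      simp [Hm, Wr, diagonal_apply_ne _ hij, hnonneg]) (fun i => hnonneg _ _)
    have heq : ∀ i, 2 * β i * x i = W i.1 δ + ∑ j : {i : V // i ≠ δ}, W i.1 j.1 * x j := by
      intro i
      have := congrFun hHx i
      simp only [Hm, sub_mulVec, Pi.sub_apply, mulVec_diagonal] at this
      rw [← this]
      simp [Wr, mulVec, dotProduct]
    have hxpos : ∀ i, 0 < x i := by
      intro i
      rcases (hx0 i).eq_or_lt with h | h
      swap
      · exact h
      exfalso
      have := conn_zero W hsymm hconn (fun j => ∃ h : j ≠ δ, x ⟨j, h⟩ = 0) (fun j k hjk hj => by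
        obtain ⟨hj, hxj⟩ := hj
        have := heq ⟨j, hj⟩
        rw [hxj, mul_zero] at this
        have hs0 : ∀ l ∈ (Finset.univ : Finset {i : V // i ≠ δ}), 0 ≤ W j l.1 * x l := fun l _ => mul_nonneg (hnonneg _ _) (hx0 l)
        have hs1 := Finset.sum_nonneg hs0
        have hd := hnonneg j δ
        have hkδ : k ≠ δ := by
          rintro rfl
          simp only at this
          linarith
        refine ⟨hkδ, ?_⟩
        have hs2 : ∑ l : {i : V // i ≠ δ}, W j l.1 * x l = 0 := by simp only at this; linarith
        have := (Finset.sum_eq_zero_iff_of_nonneg hs0).1 hs2 ⟨k, hkδ⟩ (Finset.mem_univ _)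
        exact (mul_eq_zero.1 this).resolve_left hjk.ne') i.1 δ ⟨i.2, h.symm⟩
      exact this.1 rfl
    refine ⟨fun i => Real.log (x i), ?_⟩
    ext i
    have := two_beta W δ (fun i => Real.log (x i)) i
    simp only [Real.exp_log (hxpos _)] at this
    rw [← heq] at this
    have := mul_right_cancel₀ (hxpos i).ne' this
    linarith

def extL (j : V) : ({i : V // i ≠ δ} → ℝ) →L[ℝ] ℝ :=
  if h : j = δ then 0 else ContinuousLinearMap.proj ⟨j, h⟩

lemma extL_apply (j : V) (u : {i : V // i ≠ δ} → ℝ) : extL δ j u = extendByZero δ u j := by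
  unfold extL extendByZero
  split_ifs <;> simp

def bder (u : {i : V // i ≠ δ} → ℝ) : ({i : V // i ≠ δ} → ℝ) →L[ℝ] ({i : V // i ≠ δ} → ℝ) :=
  LinearMap.toContinuousLinearMap (toLin' (diagonal (fun i => -(1/2) * Real.exp (-u i) ^ 2) * AVV W δ (extendByZero δ u)))

lemma bmap_hasFDeriv (hdiag : ∀ i, W i i = 0) (u : {i : V // i ≠ δ} → ℝ) :
    HasFDerivAt (bmap W δ) (bder W δ u) u := by
  rw [hasFDerivAt_pi']
  intro i
  have h1 : ∀ j : V, HasFDerivAt (fun v => W i.1 j * Real.exp (extL δ j v - extL δ i.1 v))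
      (W i.1 j • (Real.exp (extL δ j u - extL δ i.1 u) • (extL δ j - extL δ i.1))) u := fun j =>
    (((extL δ j).hasFDerivAt.sub (extL δ i.1).hasFDerivAt).exp).const_mul _
  have h2 := (HasFDerivAt.fun_sum (u := Finset.univ) fun j _ => h1 j).const_mul (1/2)
  have h3 : (fun v => bmap W δ v i) = fun v => (1/2) * ∑ j, W i.1 j * Real.exp (extL δ j v - extL δ i.1 v) := by
    ext v
    simp only [bmap, betaW, extL_apply]
  rw [h3]
  refine h2.congr_fderiv ?_
  ext1 x
  simp only [bder, ContinuousLinearMap.comp_apply, ContinuousLinearMap.proj_apply,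
    LinearMap.coe_toContinuousLinearMap', toLin'_apply, ← mulVec_mulVec, mulVec_diagonal, AVV_mulVec,
    Amat_apply_sum W hdiag, ContinuousLinearMap.smul_apply, ContinuousLinearMap.sum_apply,
    ContinuousLinearMap.sub_apply, smul_eq_mul, extL_apply, Finset.mul_sum]
  refine Finset.sum_congr rfl fun j _ => ?_
  rw [ext_ne, ext_ne, Real.exp_add, Real.exp_sub, Real.exp_neg]
  field_simp
  ring

lemma bder_det (u : {i : V // i ≠ δ} → ℝ) (hA : (AVV W δ (extendByZero δ u)).PosDef) :
    |(bder W δ u).det| = (1/2) ^ Fintype.card {i : V // i ≠ δ} * (∏ i, Real.exp (-u i)) ^ 2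
      * (AVV W δ (extendByZero δ u)).det := by
  have : (bder W δ u).det = (diagonal (fun i => -(1/2) * Real.exp (-u i) ^ 2) * AVV W δ (extendByZero δ u)).det := by
    rw [bder, ContinuousLinearMap.det, LinearMap.coe_toContinuousLinearMap, LinearMap.det_toLin']
  rw [this, det_mul, det_diagonal, abs_mul, abs_of_pos hA.det_pos, Finset.abs_prod]
  congr 1
  simp only [abs_mul, abs_neg, abs_pow, Real.abs_exp, Finset.prod_mul_distrib, Finset.prod_pow, Finset.prod_const]
  rw [abs_of_pos (by norm_num : (0:ℝ) < 1/2), Finset.card_univ]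

lemma change_var (hsymm : ∀ i j, W i j = W j i) (hdiag : ∀ i, W i i = 0) (hnonneg : ∀ i j, 0 ≤ W i j)
    (hconn : (SimpleGraph.fromRel fun i j : V => 0 < W i j).Connected) (θ η : {i : V // i ≠ δ} → ℝ) :
    ∫⁻ β, Fint (Wr W δ) θ η β =
      ∫⁻ u, ENNReal.ofReal |(bder W δ u).det| * Fint (Wr W δ) θ η (bmap W δ u) := by
  have h := lintegral_image_eq_lintegral_abs_det_fderiv_mul volume MeasurableSet.univ
    (fun u _ => (bmap_hasFDeriv W δ hdiag u).hasFDerivWithinAt)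
    (bmap_injective W δ hsymm hdiag hnonneg hconn).injOn (Fint (Wr W δ) θ η)
  rw [setLIntegral_univ] at h
  rw [← h, bmap_range W δ hsymm hdiag hnonneg hconn, ← lintegral_indicator (measurableSet_pd _)]
  refine lintegral_congr fun β => ?_
  by_cases hp : (Hm (Wr W δ) β).PosDef
  · rw [Set.indicator_of_mem (by exact hp)]
  · rw [Set.indicator_of_notMem (by exact hp), Fint, Gint_neg hp]

end

section
open Matrix
variable {V : Type*} [Fintype V] [DecidableEq V] (W : V → V → ℝ) (δ : V)

lemma sum_b_theta (hdiag : ∀ i, W i i = 0) (b : V → ℝ) (u s : {i : V // i ≠ δ} → ℝ) :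
    ∑ i : {i : V // i ≠ δ}, b i.1 * thetaW W (extendByZero δ u) (extendByZero δ s) i.1
      = (fun i : {i : V // i ≠ δ} => b i.1 * Real.exp (-u i)) ⬝ᵥ (AVV W δ (extendByZero δ u) *ᵥ s) := by
  unfold dotProduct
  refine Finset.sum_congr rfl fun i _ => ?_
  rw [AVV_mulVec, Amat_theta W hdiag, ext_ne]
  simp only [Real.exp_neg]
  field_simp

lemma quad_v (hsymm : ∀ i j, W i j = W j i) (hdiag : ∀ i, W i i = 0) (b : V → ℝ) (hbδ : b δ = 0)
    (u : {i : V // i ≠ δ} → ℝ) :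
    (fun i : {i : V // i ≠ δ} => b i.1 * Real.exp (-u i)) ⬝ᵥ
      (AVV W δ (extendByZero δ u) *ᵥ (fun i : {i : V // i ≠ δ} => b i.1 * Real.exp (-u i)))
      = 2 * ∑ i : {i : V // i ≠ δ}, b i.1 ^ 2 * bmap W δ u i - ∑ i, ∑ j, W i j * (b i * b j) := by
  set U := extendByZero δ u with hU
  have hext : extendByZero δ (fun i : {i : V // i ≠ δ} => b i.1 * Real.exp (-u i))
      = fun i => b i * Real.exp (-U i) := by
    ext i
    by_cases h : i = δ
    · subst h; rw [ext_delta, hbδ, zero_mul]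
    · have := ext_ne δ (fun i : {i : V // i ≠ δ} => b i.1 * Real.exp (-u i)) ⟨i, h⟩
      have h2 := ext_ne δ u ⟨i, h⟩
      simp only at this h2
      rw [this, hU, h2]
  rw [← AVV_quad, hext, Amat_quad W hsymm hdiag]
  have h1 : ∑ i : {i : V // i ≠ δ}, b i.1 ^ 2 * bmap W δ u i = ∑ i, b i ^ 2 * betaW W U i := by
    rw [sum_split δ (fun i => b i ^ 2 * betaW W U i), hbδ]
    simp [bmap, hU]
  rw [h1]
  have h2 : 2 * ∑ i, b i ^ 2 * betaW W U i = ∑ i, ∑ j, W i j * Real.exp (U j - U i) * b i ^ 2 := by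
    rw [Finset.mul_sum]
    refine Finset.sum_congr rfl fun i _ => ?_
    rw [betaW, ← Finset.sum_mul]; ring
  have h3 : ∑ i, ∑ j, W i j * Real.exp (U j - U i) * b i ^ 2 =
      ∑ i, ∑ j, W i j * Real.exp (U i - U j) * b j ^ 2 := by
    rw [Finset.sum_comm]
    refine Finset.sum_congr rfl fun j _ => Finset.sum_congr rfl fun i _ => ?_
    rw [hsymm i j]
  have h4 : ∑ i, ∑ j, W i j * Real.exp (U i + U j) * (b i * Real.exp (-U i) - b j * Real.exp (-U j)) ^ 2
      = ∑ i, ∑ j, W i j * Real.exp (U j - U i) * b i ^ 2 + ∑ i, ∑ j, W i j * Real.exp (U i - U j) * b j ^ 2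
        - 2 * ∑ i, ∑ j, W i j * (b i * b j) := by
    simp only [Finset.mul_sum, ← Finset.sum_add_distrib, ← Finset.sum_sub_distrib]
    refine Finset.sum_congr rfl fun i _ => Finset.sum_congr rfl fun j _ => ?_
    rw [Real.exp_add, Real.exp_neg, Real.exp_neg, Real.exp_sub, Real.exp_sub]
    field_simp
    ring
  rw [h4, ← h3, h2]; ring

lemma cosh_sum (hsymm : ∀ i j, W i j = W j i) (hdiag : ∀ i, W i i = 0) (u : {i : V // i ≠ δ} → ℝ) :
    (1 / 2) * ∑ i, ∑ j, W i j * (Real.cosh (extendByZero δ u i - extendByZero δ u j) - 1)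
      = ∑ i, bmap W δ u i + (1 / 2) * ((fun i : {i : V // i ≠ δ} => W i.1 δ) ⬝ᵥ fun i => Real.exp (u i))
        - (1 / 2) * ∑ i, ∑ j, W i j := by
  set U := extendByZero δ u with hU
  have h1 : ∑ i, betaW W U i = ∑ i, bmap W δ u i
      + (1 / 2) * ((fun i : {i : V // i ≠ δ} => W i.1 δ) ⬝ᵥ fun i => Real.exp (u i)) := by
    rw [sum_split δ (fun i => betaW W U i), add_comm]
    congr 1
    rw [betaW, sum_split δ, hdiag, hU, ext_delta]
    simp only [ext_ne, dotProduct, zero_mul, zero_add, sub_zero, hsymm δ]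
  have h2 : 2 * ∑ i, betaW W U i = ∑ i, ∑ j, W i j * Real.exp (U j - U i) := by
    rw [Finset.mul_sum]
    refine Finset.sum_congr rfl fun i _ => ?_
    rw [betaW]; ring
  have h3 : ∑ i, ∑ j, W i j * Real.exp (U j - U i) = ∑ i, ∑ j, W i j * Real.exp (U i - U j) := by
    rw [Finset.sum_comm]
    refine Finset.sum_congr rfl fun j _ => Finset.sum_congr rfl fun i _ => ?_
    rw [hsymm i j]
  have h4 : ∑ i, ∑ j, W i j * (Real.cosh (U i - U j) - 1) =
      (1 / 2) * (∑ i, ∑ j, W i j * Real.exp (U j - U i)) + (1 / 2) * (∑ i, ∑ j, W i j * Real.exp (U i - U j))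
        - ∑ i, ∑ j, W i j := by
    simp only [Finset.mul_sum, ← Finset.sum_add_distrib, ← Finset.sum_sub_distrib]
    refine Finset.sum_congr rfl fun i _ => Finset.sum_congr rfl fun j _ => ?_
    rw [Real.cosh_eq, neg_sub]; ring
  rw [h4, ← h1, ← h3, ← h2]; ring

lemma quad_H (a : {i : V // i ≠ δ} → ℝ) (β : {i : V // i ≠ δ} → ℝ) :
    a ⬝ᵥ (Hm (Wr W δ) β *ᵥ a) = 2 * ∑ i, a i ^ 2 * β i
      - ∑ i : {i : V // i ≠ δ}, ∑ j : {i : V // i ≠ δ}, W i.1 j.1 * (a i * a j) := by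
  rw [Finset.mul_sum, ← Finset.sum_sub_distrib]
  unfold dotProduct
  refine Finset.sum_congr rfl fun i _ => ?_
  simp only [Hm, sub_mulVec, Pi.sub_apply, mulVec_diagonal]
  simp only [Wr, mulVec, dotProduct, of_apply, mul_sub, Finset.mul_sum]
  congr 1
  · ring
  · exact Finset.sum_congr rfl fun j _ => by ring

lemma exponent_eq (hsymm : ∀ i j, W i j = W j i) (hdiag : ∀ i, W i i = 0) (hnonneg : ∀ i j, 0 ≤ W i j)
    (hconn : (SimpleGraph.fromRel fun i j : V => 0 < W i j).Connected)
    (a b : V → ℝ) (hbδ : b δ = 0) (u s : {i : V // i ≠ δ} → ℝ) :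
    -(1 / 2) * (∑ i, ∑ j, extendByZero δ s i * Amat W (extendByZero δ u) i j * extendByZero δ s j)
      + -((1 / 2) * ∑ i, ∑ j, W i j * (Real.cosh (extendByZero δ u i - extendByZero δ u j) - 1))
      + -(∑ i : {i : V // i ≠ δ},
        (((a i.1) ^ 2 + (b i.1) ^ 2 - 1) * betaW W (extendByZero δ u) i.1
          + b i.1 * thetaW W (extendByZero δ u) (extendByZero δ s) i.1))
    = ((1 / 2) * ∑ i, ∑ j, W i j - (1 / 2) * ∑ i, ∑ j, W i j * (b i * b j)
        - (1 / 2) * ∑ i : {i : V // i ≠ δ}, ∑ j : {i : V // i ≠ δ}, W i.1 j.1 * (a i.1 * a j.1))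
      + -((s + fun i => b i.1 * Real.exp (-u i)) ⬝ᵥ
          (AVV W δ (extendByZero δ u) *ᵥ (s + fun i => b i.1 * Real.exp (-u i)))) / 2
      + -((fun i : {i : V // i ≠ δ} => a i.1) ⬝ᵥ (Hm (Wr W δ) (bmap W δ u) *ᵥ fun i => a i.1)
        + (fun i : {i : V // i ≠ δ} => W i.1 δ) ⬝ᵥ ((Hm (Wr W δ) (bmap W δ u))⁻¹ *ᵥ fun i => W i.1 δ)) / 2 := by
  have hA := AVV_posDef W δ hsymm hdiag hnonneg hconn (extendByZero δ u)
  have hAT : (AVV W δ (extendByZero δ u))ᵀ = AVV W δ (extendByZero δ u) := ((posDef_real_iff _).1 hA).1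
  have hH := Hm_bmap_posDef W δ hsymm hdiag hnonneg hconn u
  have h1 := pd_inv_mul hH (fun i => Real.exp (u i))
  rw [Hm_bmap_mulVec] at h1
  rw [h1, quad_H, cosh_sum W δ hsymm hdiag, AVV_quad]
  have hsplit : ∑ i : {i : V // i ≠ δ},
        (((a i.1) ^ 2 + (b i.1) ^ 2 - 1) * betaW W (extendByZero δ u) i.1
          + b i.1 * thetaW W (extendByZero δ u) (extendByZero δ s) i.1) =
      ∑ i : {i : V // i ≠ δ}, a i.1 ^ 2 * bmap W δ u i + ∑ i : {i : V // i ≠ δ}, b i.1 ^ 2 * bmap W δ u i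
       - ∑ i, bmap W δ u i
       + ∑ i : {i : V // i ≠ δ}, b i.1 * thetaW W (extendByZero δ u) (extendByZero δ s) i.1 := by
    simp only [← Finset.sum_add_distrib, ← Finset.sum_sub_distrib]
    exact Finset.sum_congr rfl fun i _ => by simp only [bmap]; ring
  rw [hsplit, sum_b_theta W δ hdiag]
  have hv := quad_v W δ hsymm hdiag b hbδ u
  set v := (fun i : {i : V // i ≠ δ} => b i.1 * Real.exp (-u i)) with hvdef
  rw [mulVec_add, add_dotProduct, dotProduct_add, dotProduct_add, hv]
  have hsym : s ⬝ᵥ (AVV W δ (extendByZero δ u) *ᵥ v) = v ⬝ᵥ (AVV W δ (extendByZero δ u) *ᵥ s) := by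
    rw [dotProduct_mulVec, ← mulVec_transpose, hAT, dotProduct_comm]
  rw [hsym]
  ring

lemma inner_int (hsymm : ∀ i j, W i j = W j i) (hdiag : ∀ i, W i i = 0) (hnonneg : ∀ i j, 0 ≤ W i j)
    (hconn : (SimpleGraph.fromRel fun i j : V => 0 < W i j).Connected)
    (a b : V → ℝ) (hbδ : b δ = 0) (u : {i : V // i ≠ δ} → ℝ) :
    ∫⁻ s : {i : V // i ≠ δ} → ℝ, ENNReal.ofReal (rhoW W δ (extendByZero δ u) (extendByZero δ s) *
      (∏ i : {i : V // i ≠ δ}, Real.exp (-(extendByZero δ u i.1)) / (2 * Real.pi))) *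
      ENNReal.ofReal (Real.exp (-(∑ i : {i : V // i ≠ δ},
        (((a i.1) ^ 2 + (b i.1) ^ 2 - 1) * betaW W (extendByZero δ u) i.1
          + b i.1 * thetaW W (extendByZero δ u) (extendByZero δ s) i.1))))
    = ENNReal.ofReal ((2 * √(2 * π) / (2 * π)) ^ Fintype.card {i : V // i ≠ δ} *
        Real.exp ((1 / 2) * ∑ i, ∑ j, W i j - (1 / 2) * ∑ i, ∑ j, W i j * (b i * b j)
        - (1 / 2) * ∑ i : {i : V // i ≠ δ}, ∑ j : {i : V // i ≠ δ}, W i.1 j.1 * (a i.1 * a j.1))) *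
      (ENNReal.ofReal |(bder W δ u).det| *
        Fint (Wr W δ) (fun i => a i.1) (fun i => W i.1 δ) (bmap W δ u)) := by
  have hA := AVV_posDef W δ hsymm hdiag hnonneg hconn (extendByZero δ u)
  have hH := Hm_bmap_posDef W δ hsymm hdiag hnonneg hconn u
  set C := ((1 / 2) * ∑ i, ∑ j, W i j - (1 / 2) * ∑ i, ∑ j, W i j * (b i * b j)
        - (1 / 2) * ∑ i : {i : V // i ≠ δ}, ∑ j : {i : V // i ≠ δ}, W i.1 j.1 * (a i.1 * a j.1)) with hC
  set R := -((fun i : {i : V // i ≠ δ} => a i.1) ⬝ᵥ (Hm (Wr W δ) (bmap W δ u) *ᵥ fun i => a i.1)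
        + (fun i : {i : V // i ≠ δ} => W i.1 δ) ⬝ᵥ ((Hm (Wr W δ) (bmap W δ u))⁻¹ *ᵥ fun i => W i.1 δ)) / 2 with hR
  set D := (AVV W δ (extendByZero δ u)).det with hD
  have hDpos : 0 < D := hA.det_pos
  set v := (fun i : {i : V // i ≠ δ} => b i.1 * Real.exp (-u i)) with hvdef
  set P := ∏ i, Real.exp (-u i) with hP
  have hPpos : 0 < P := Finset.prod_pos fun i _ => Real.exp_pos _
  set n := Fintype.card {i : V // i ≠ δ} with hn
  have hprod : (∏ i : {i : V // i ≠ δ}, Real.exp (-(extendByZero δ u i.1)) / (2 * Real.pi)) = P / (2 * π) ^ n := by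
    simp only [ext_ne, Finset.prod_div_distrib, Finset.prod_const, Finset.card_univ, ← hP, ← hn]
  have hintegrand : ∀ s : {i : V // i ≠ δ} → ℝ,
      ENNReal.ofReal (rhoW W δ (extendByZero δ u) (extendByZero δ s) *
      (∏ i : {i : V // i ≠ δ}, Real.exp (-(extendByZero δ u i.1)) / (2 * Real.pi))) *
      ENNReal.ofReal (Real.exp (-(∑ i : {i : V // i ≠ δ},
        (((a i.1) ^ 2 + (b i.1) ^ 2 - 1) * betaW W (extendByZero δ u) i.1
          + b i.1 * thetaW W (extendByZero δ u) (extendByZero δ s) i.1))))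
      = ENNReal.ofReal (D * (P / (2 * π) ^ n) * Real.exp C * Real.exp R) *
        ENNReal.ofReal (Real.exp (-((s + v) ⬝ᵥ (AVV W δ (extendByZero δ u) *ᵥ (s + v))) / 2)) := by
    intro s
    have he := exponent_eq W δ hsymm hdiag hnonneg hconn a b hbδ u s
    rw [← hC, ← hR, ← hvdef] at he
    have he2 := congrArg Real.exp he
    simp only [Real.exp_add] at he2
    rw [hprod, ← ENNReal.ofReal_mul' (Real.exp_pos _).le, ← ENNReal.ofReal_mul' (Real.exp_pos _).le]
    congr 1
    unfold rhoW
    rw [← hD]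
    linear_combination (D * (P / (2 * π) ^ n)) * he2
  rw [lintegral_congr hintegrand, lintegral_const_mul' _ _ ENNReal.ofReal_ne_top,
    lintegral_add_right_eq_self (fun s => ENNReal.ofReal (Real.exp (-(s ⬝ᵥ (AVV W δ (extendByZero δ u) *ᵥ s)) / 2))) v,
    gauss_multi hA, Fint, Gint_pos hH, bder_det W δ u hA, Hm_bmap_det W δ hdiag, ← hR, ← hD, ← hP, ← hn]
  rw [Real.sqrt_mul (sq_nonneg P) D, Real.sqrt_sq hPpos.le,
    ← ENNReal.ofReal_mul (by positivity), ← ENNReal.ofReal_mul (by positivity), ← ENNReal.ofReal_mul (by positivity)]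
  congr 1
  have : √D ≠ 0 := by positivity
  have hpi : (0:ℝ) < 2 * π := by positivity
  simp only [div_pow, mul_pow, one_pow]
  field_simp

lemma continuous_ext : Continuous (extendByZero δ : ({i : V // i ≠ δ} → ℝ) → V → ℝ) := by
  refine continuous_pi fun i => ?_
  have : (fun x => extendByZero δ x i) = fun x => extL δ i x := by
    ext x; rw [extL_apply]
  rw [this]; exact (extL δ i).continuous

lemma continuous_Amat : Continuous (fun u : V → ℝ => Amat W u) := by
  refine continuous_matrix fun i j => ?_
  simp only [Amat, of_apply]
  split_ifs <;> fun_prop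

lemma continuous_dens : Continuous (fun p : (V → ℝ) × (V → ℝ) => rhoW W δ p.1 p.2 *
      ∏ i : {i : V // i ≠ δ}, Real.exp (-(p.1 i.1)) / (2 * Real.pi)) := by
  have hA : ∀ i j, Continuous (fun u : V → ℝ => Amat W u i j) := fun i j =>
    (continuous_Amat W).matrix_elem i j
  have hA' : ∀ i j, Continuous (fun p : (V → ℝ) × (V → ℝ) => Amat W p.1 i j) := fun i j =>
    (hA i j).comp continuous_fst
  have hdet : Continuous (fun p : (V → ℝ) × (V → ℝ) => (AVV W δ p.1).det) := by
    refine Continuous.matrix_det ?_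
    refine continuous_matrix fun i j => ?_
    exact hA' _ _
  unfold rhoW
  fun_prop

lemma continuous_obs (a b : V → ℝ) : Continuous (fun p : (V → ℝ) × (V → ℝ) =>
    Real.exp (-(∑ i : {i : V // i ≠ δ},
        (((a i.1) ^ 2 + (b i.1) ^ 2 - 1) * betaW W p.1 i.1
          + b i.1 * thetaW W p.1 p.2 i.1)))) := by
  unfold betaW thetaW
  fun_prop

lemma final_const (hsymm : ∀ i j, W i j = W j i) (hdiag : ∀ i, W i i = 0)
    (a b : V → ℝ) (haδ : a δ = 1) :
    ((2 * √(2 * π) / (2 * π)) ^ Fintype.card {i : V // i ≠ δ} *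
        Real.exp ((1 / 2) * ∑ i, ∑ j, W i j - (1 / 2) * ∑ i, ∑ j, W i j * (b i * b j)
        - (1 / 2) * ∑ i : {i : V // i ≠ δ}, ∑ j : {i : V // i ≠ δ}, W i.1 j.1 * (a i.1 * a j.1))) *
      (Real.exp (-((fun i : {i : V // i ≠ δ} => W i.1 δ) ⬝ᵥ fun i => a i.1))
        * √(π / 2) ^ Fintype.card {i : V // i ≠ δ} / ∏ i : {i : V // i ≠ δ}, a i.1) = LW W δ a b := by
  have hone : (2 * √(2 * π) / (2 * π)) * √(π / 2) = 1 := by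
    have : √(2 * π) * √(π / 2) = π := by
      rw [← Real.sqrt_mul (by positivity), show 2 * π * (π / 2) = π ^ 2 by ring, Real.sqrt_sq Real.pi_pos.le]
    have hp := Real.pi_pos
    field_simp
    linarith
  have hone' := congrArg (fun x => x ^ Fintype.card {i : V // i ≠ δ}) hone
  simp only [mul_pow, one_pow] at hone'
  have haa : ∑ i, ∑ j, W i j * (a i * a j) =
      ∑ i : {i : V // i ≠ δ}, ∑ j : {i : V // i ≠ δ}, W i.1 j.1 * (a i.1 * a j.1)
       + 2 * ((fun i : {i : V // i ≠ δ} => W i.1 δ) ⬝ᵥ fun i => a i.1) := by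
    rw [sum_split δ]
    have : ∀ i, ∑ j, W i j * (a i * a j) = W i δ * a i + ∑ j : {i : V // i ≠ δ}, W i j.1 * (a i * a j.1) := by
      intro i
      rw [sum_split δ, haδ, mul_one]
    simp only [this]
    simp only [Finset.sum_add_distrib, hdiag, haδ, dotProduct, hsymm δ]
    ring
  have hex : ∑ i, ∑ j, W i j * (a i * a j + b i * b j - 1) =
      ∑ i, ∑ j, W i j * (a i * a j) + ∑ i, ∑ j, W i j * (b i * b j) - ∑ i, ∑ j, W i j := by
    simp only [← Finset.sum_add_distrib, ← Finset.sum_sub_distrib]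
    refine Finset.sum_congr rfl fun i _ => Finset.sum_congr rfl fun j _ => by ring
  unfold LW
  rw [hex, haa, Finset.prod_inv_distrib]
  set q := ((fun i : {i : V // i ≠ δ} => W i.1 δ) ⬝ᵥ fun i => a i.1)
  set C := ((1 / 2) * ∑ i, ∑ j, W i j - (1 / 2) * ∑ i, ∑ j, W i j * (b i * b j)
        - (1 / 2) * ∑ i : {i : V // i ≠ δ}, ∑ j : {i : V // i ≠ δ}, W i.1 j.1 * (a i.1 * a j.1)) with hC
  rw [show -(1 / 2 * (∑ i : {i : V // i ≠ δ}, ∑ j : {i : V // i ≠ δ}, W i.1 j.1 * (a i.1 * a j.1) + 2 * q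
      + ∑ i, ∑ j, W i j * (b i * b j) - ∑ i, ∑ j, W i j)) = C + -q by rw [hC]; ring, Real.exp_add, div_eq_mul_inv]
  linear_combination (Real.exp C * Real.exp (-q) * (∏ i : {i : V // i ≠ δ}, a i.1)⁻¹) * hone'

end

theorem stmt1 {V : Type*} [Fintype V] [DecidableEq V]
    (W : V → V → ℝ) (δ : V)
    (hsymm : ∀ i j, W i j = W j i)
    (hdiag : ∀ i, W i i = 0)
    (hnonneg : ∀ i j, 0 ≤ W i j)
    (hconn : (SimpleGraph.fromRel fun i j : V => 0 < W i j).Connected)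
    (a b : V → ℝ) (ha : ∀ i, 0 < a i) (haδ : a δ = 1) (hbδ : b δ = 0) :
    ∫ p, Real.exp (-(∑ i : {i : V // i ≠ δ},
        (((a i.1) ^ 2 + (b i.1) ^ 2 - 1) * betaW W p.1 i.1
          + b i.1 * thetaW W p.1 p.2 i.1))) ∂(muW W δ)
      = LW W δ a b := by
  have hobs := continuous_obs W δ a b
  have hdens := continuous_dens W δ
  rw [integral_eq_lintegral_of_nonneg_ae (Filter.Eventually.of_forall fun p => (Real.exp_pos _).le)
    hobs.aestronglyMeasurable]
  have hL : 0 ≤ LW W δ a b := by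
    unfold LW
    exact mul_nonneg (Real.exp_pos _).le (Finset.prod_nonneg fun i _ => inv_nonneg.2 (ha _).le)
  rw [← ENNReal.toReal_ofReal hL]
  congr 1
  rw [muW, lintegral_withDensity_eq_lintegral_mul _ hdens.measurable.ennreal_ofReal
    hobs.measurable.ennreal_ofReal, baseMeasure]
  have hmap : Measurable (fun p : ({i : V // i ≠ δ} → ℝ) × ({i : V // i ≠ δ} → ℝ) =>
      (extendByZero δ p.1, extendByZero δ p.2)) :=
    (((continuous_ext δ).comp continuous_fst).prodMk ((continuous_ext δ).comp continuous_snd)).measurable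
  have hm := (hdens.measurable.ennreal_ofReal).mul (hobs.measurable.ennreal_ofReal)
  rw [lintegral_map hm hmap, Measure.volume_eq_prod, lintegral_prod _ (by exact (hm.comp hmap).aemeasurable)]
  simp only [Pi.mul_apply]
  rw [lintegral_congr fun u => inner_int W δ hsymm hdiag hnonneg hconn a b hbδ u,
    lintegral_const_mul' _ _ ENNReal.ofReal_ne_top, ← change_var W δ hsymm hdiag hnonneg hconn,
    claim_all (Wr W δ) (fun i => a i.1) (fun i => W i.1 δ) (fun i j => hsymm _ _) (fun i j => hnonneg _ _)
      (fun i => ha _) (fun i => hnonneg _ _), ← ENNReal.ofReal_mul (by positivity),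
    final_const W δ hsymm hdiag a b haδ]
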